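/- There is a constant n₀ such that for every n ≥ n₀ the following holds. Fix disjoint sets L, R with |L| = |R| = n and a bijection M : L → R. Then the number of subsets D ⊆ R × L for which the digraph G_D is NOT 8n-balanced is at most 2^{n²}/n. Equivalently, a uniformly random D ⊆ R × L yields an 8n-balanced graph G_D with probability at least 1 − 1/n. -/

import Mathlib

open Finset

/-- The number of edges of the digraph `G_D` (matching edges `(u, M u)` for `u ∈ L`,
together with the edges in `D`) going from `S` to its complement. -/
def eCount {V : Type} [Fintype V] [DecidableEq V]
    (L : Finset V) (M : V → V) (D : Finset (V × V)) (S : Finset V) : ℕ :=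
  (Finset.univ.filter
    (fun p : V × V => ((p.1 ∈ L ∧ p.2 = M p.1) ∨ p ∈ D) ∧ p.1 ∈ S ∧ p.2 ∉ S)).card

/-- `G_D` is `β`-balanced: strongly connected, and every cut has at most `β` times
as many edges in one direction as in the other. -/
def BalancedGD {V : Type} [Fintype V] [DecidableEq V]
    (β : ℝ) (L : Finset V) (M : V → V) (D : Finset (V × V)) : Prop :=
  (∀ u v : V, Relation.ReflTransGen (fun x y => (x ∈ L ∧ y = M x) ∨ (x, y) ∈ D) u v) ∧
  ∀ S : Finset V, (eCount L M D S : ℝ) ≤ β * (eCount L M D Sᶜ : ℝ)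

/-- If fewer than a quarter as many pairs of `X × Y` as `X` has elements are related, then some
large enough subrectangle of `X × Y` has no related pair at all. -/
lemma exists_empty_rectangle {V : Type} [DecidableEq V] (r : V → V → Prop)
    [DecidableRel r] {n : ℕ} {X Y : Finset V} (hn : 32 ≤ n)
    (hd : 4 * #{p ∈ X ×ˢ Y | r p.1 p.2} < #X) (hxy : #X ≤ #Y) (hny : n ≤ #Y + 2 * #X) :
    ∃ X' ⊆ X, ∃ Y' ⊆ Y, (∀ a ∈ X', ∀ b ∈ Y', ¬ r a b) ∧
      (4 * n ≤ #X' * #Y' ∨ #X' = 1 ∧ #Y' = n - 32) := by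
  set d := #{p ∈ X ×ˢ Y | r p.1 p.2} with hd_def
  set Z := {a ∈ X | ∀ b ∈ Y, ¬ r a b} with hZ
  have hZX : Z ⊆ X := filter_subset _ _
  have hZd : #(X \ Z) ≤ d := by
    have hsub : X \ Z ⊆ image Prod.fst {p ∈ X ×ˢ Y | r p.1 p.2} := by
      intro a ha
      simp only [hZ, mem_sdiff, mem_filter, not_and, not_forall, not_not] at ha
      obtain ⟨haX, ha⟩ := ha
      obtain ⟨b, hb, hab⟩ := ha haX
      exact mem_image.2 ⟨(a, b), by simp [haX, hb, hab], rfl⟩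
    exact (card_le_card hsub).trans card_image_le
  have hcard : #(X \ Z) + #Z = #X := card_sdiff_add_card_eq_card hZX
  have hempty : ∀ a ∈ Z, ∀ b ∈ Y, ¬ r a b := fun a ha => (mem_filter.1 ha).2
  by_cases hx : #X ≤ 16
  · obtain ⟨v, hv⟩ : Z.Nonempty := card_pos.1 (by omega)
    obtain ⟨Y', hY', hY'c⟩ := exists_subset_card_eq (s := Y) (n := n - 32) (by omega)
    refine ⟨{v}, by simpa using hZX hv, Y', hY', ?_, Or.inr ⟨card_singleton v, hY'c⟩⟩
    intro a ha b hb
    rw [mem_singleton.1 ha]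
    exact hempty v hv b (hY' hb)
  · refine ⟨Z, hZX, Y, Subset.rfl, hempty, Or.inl ?_⟩
    calc 4 * n ≤ 12 * #Y := by omega
      _ ≤ #Z * #Y := Nat.mul_le_mul_right _ (by omega)

lemma card_powerset_filter_disjoint_le {V : Type} [DecidableEq V] {n : ℕ}
    {L R X Y : Finset V} (hL : #L = n) (hR : #R = n) (hX : X ⊆ R) (hY : Y ⊆ L) :
    #{D ∈ (R ×ˢ L).powerset | ∀ a ∈ X, ∀ b ∈ Y, (a, b) ∉ D} ≤ 2 ^ (n ^ 2 - #X * #Y) := by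
  have hsub : {D ∈ (R ×ˢ L).powerset | ∀ a ∈ X, ∀ b ∈ Y, (a, b) ∉ D} ⊆
      ((R ×ˢ L) \ (X ×ˢ Y)).powerset := by
    intro D hD
    obtain ⟨hD, hDe⟩ := mem_filter.1 hD
    rw [mem_powerset] at hD ⊢
    rintro ⟨a, b⟩ hab
    refine mem_sdiff.2 ⟨hD hab, fun h => ?_⟩
    obtain ⟨ha, hb⟩ := mem_product.1 h
    exact hDe a ha b hb hab
  refine (card_le_card hsub).trans_eq ?_
  rw [card_powerset, card_sdiff_of_subset (product_subset_product hX hY), card_product,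
    card_product, hL, hR, sq]

lemma card_add_card_filter_eq {V : Type} [DecidableEq V] {L R : Finset V} {M : V → V}
    (hM : Set.BijOn M ↑L ↑R) (S : Finset V) :
    #(R ∩ S) + #{u ∈ L | u ∈ S ∧ M u ∉ S} = #(L ∩ S) + #{u ∈ L | u ∉ S ∧ M u ∈ S} := by
  have hb : #(R ∩ S) = #{u ∈ L | M u ∈ S} := by
    symm
    refine card_bij (fun u _ => M u) ?_ ?_ ?_
    · intro u hu
      obtain ⟨hu, huS⟩ := mem_filter.1 hu
      exact mem_inter.2 ⟨by exact_mod_cast hM.mapsTo hu, huS⟩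
    · intro u hu v hv h
      exact hM.injOn (mem_filter.1 hu).1 (mem_filter.1 hv).1 h
    · intro w hw
      obtain ⟨hw, hwS⟩ := mem_inter.1 hw
      obtain ⟨u, hu, rfl⟩ := hM.surjOn hw
      exact ⟨u, mem_filter.2 ⟨hu, hwS⟩, rfl⟩
  have h1 := card_filter_add_card_filter_not (s := {u ∈ L | M u ∈ S}) (fun u => u ∈ S)
  have h2 := card_filter_add_card_filter_not (s := {u ∈ L | u ∈ S}) (fun u => M u ∈ S)
  have h3 : L ∩ S = {u ∈ L | u ∈ S} := (filter_mem_eq_inter).symm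
  simp only [filter_filter] at h1 h2
  simp only [and_comm (a := M _ ∈ S)] at h1
  rw [hb, h3]
  omega

section Cuts

variable {V : Type} [Fintype V] [DecidableEq V] {L R : Finset V} {M : V → V}
  {D : Finset (V × V)} {n : ℕ}

lemma card_filter_add_card_filter_le_eCount_compl (hdisj : Disjoint L R)
    (S : Finset V) :
    #{u ∈ L | u ∉ S ∧ M u ∈ S} + #{p ∈ (R \ S) ×ˢ (L ∩ S) | p ∈ D} ≤ eCount L M D Sᶜ := by
  have hinj : #{u ∈ L | u ∉ S ∧ M u ∈ S} =
      #(image (fun u => (u, M u)) {u ∈ L | u ∉ S ∧ M u ∈ S}) :=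
    (card_image_of_injective _ fun a b h => (Prod.ext_iff.1 h).1).symm
  rw [hinj, ← card_union_of_disjoint]
  · refine card_le_card ?_
    rintro ⟨a, b⟩ hp
    simp only [mem_union, mem_image, mem_filter, Prod.mk.injEq, mem_product, mem_sdiff,
      mem_inter] at hp
    simp only [mem_filter, mem_univ, true_and, mem_compl, not_not]
    rcases hp with ⟨u, ⟨hu, hu1, hu2⟩, rfl, rfl⟩ | ⟨⟨⟨ha, haS⟩, hb, hbS⟩, hab⟩
    · exact ⟨Or.inl ⟨hu, rfl⟩, hu1, hu2⟩
    · exact ⟨Or.inr hab, haS, hbS⟩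
  · rw [disjoint_left]
    rintro ⟨a, b⟩ h1 h2
    simp only [mem_image, mem_filter, Prod.mk.injEq, mem_product, mem_sdiff,
      mem_inter] at h1 h2
    obtain ⟨u, ⟨hu, -⟩, rfl, rfl⟩ := h1
    exact disjoint_left.1 hdisj hu h2.1.1.1

lemma eCount_le (hL : #L = n) (hR : #R = n)
    (hM : Set.BijOn M ↑L ↑R) (hD : D ⊆ R ×ˢ L) (S : Finset V) :
    eCount L M D S ≤ n * #{u ∈ L | u ∉ S ∧ M u ∈ S} + 2 * (#(R \ S) * #(L ∩ S)) := by
  have hsub : eCount L M D S ≤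
      #{u ∈ L | u ∈ S ∧ M u ∉ S} + #(R ∩ S) * #(L \ S) := by
    rw [← card_product]
    refine le_trans (card_le_card ?_) ((card_union_le
      (image (fun u => (u, M u)) {u ∈ L | u ∈ S ∧ M u ∉ S}) _).trans
        (Nat.add_le_add_right card_image_le _))
    rintro ⟨a, b⟩ hp
    simp only [mem_filter, mem_univ, true_and] at hp
    simp only [mem_union, mem_image, mem_filter, Prod.mk.injEq, mem_product, mem_sdiff,
      mem_inter]
    obtain ⟨⟨ha, rfl⟩ | hab, haS, hbS⟩ := hp
    · exact Or.inl ⟨a, ⟨ha, haS, hbS⟩, rfl, rfl⟩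
    · obtain ⟨ha, hb⟩ := mem_product.1 (hD hab)
      exact Or.inr ⟨⟨ha, haS⟩, hb, hbS⟩
  have heq := card_add_card_filter_eq hM S
  have hx : #(R \ S) + #(R ∩ S) = n := by rw [← hR]; exact card_sdiff_add_card_inter R S
  have hy : #(L \ S) + #(L ∩ S) = n := by rw [← hL]; exact card_sdiff_add_card_inter L S
  have h1 : #{u ∈ L | u ∈ S ∧ M u ∉ S} ≤ #(L ∩ S) := card_le_card fun u hu => by
    simp only [mem_filter] at hu
    exact mem_inter.2 ⟨hu.1, hu.2.1⟩
  have h2 : #{u ∈ L | u ∈ S ∧ M u ∉ S} ≤ #(R \ S) := by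
    refine card_le_card_of_injOn M (fun u hu => ?_) (fun u hu v hv h => ?_)
    · have hu := mem_filter.1 (mem_coe.1 hu)
      exact mem_coe.2 (mem_sdiff.2 ⟨by exact_mod_cast hM.mapsTo hu.1, hu.2.2⟩)
    · exact hM.injOn (mem_filter.1 (mem_coe.1 hu)).1 (mem_filter.1 (mem_coe.1 hv)).1 h
  generalize #{u ∈ L | u ∈ S ∧ M u ∉ S} = α at *
  generalize #{u ∈ L | u ∉ S ∧ M u ∈ S} = k at *
  generalize #(R \ S) = x at *
  generalize #(L ∩ S) = y at *
  generalize #(R ∩ S) = b at *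
  generalize #(L \ S) = c at *
  have h3 : α ≤ x * y := by
    rcases Nat.eq_zero_or_pos y with rfl | hy0
    · omega
    · exact h2.trans (Nat.le_mul_of_pos_right x hy0)
  have h4 : b * c ≤ n * k + x * y := by
    have hb : (b : ℤ) = n - x := by omega
    have hc : (c : ℤ) = n - y := by omega
    have hk : (n : ℤ) - x - y ≤ k := by omega
    zify
    rw [hb, hc]
    nlinarith [mul_le_mul_of_nonneg_left hk (Int.natCast_nonneg n)]
  omega

/-- An unbalanced `G_D` has a cut `S` that receives few edges compared with
`|R \ S| * |L ∩ S|`. -/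
lemma exists_sparse_cut_of_not_balancedGD (hdisj : Disjoint L R)
    (hcov : L ∪ R = univ) (hL : #L = n) (hR : #R = n) (hM : Set.BijOn M ↑L ↑R)
    (hD : D ⊆ R ×ˢ L) (hbal : ¬ BalancedGD (8 * n : ℝ) L M D) :
    ∃ S : Finset V, 8 * n * (#{u ∈ L | u ∉ S ∧ M u ∈ S} +
      #{p ∈ (R \ S) ×ˢ (L ∩ S) | p ∈ D}) <
        n * #{u ∈ L | u ∉ S ∧ M u ∈ S} + 2 * (#(R \ S) * #(L ∩ S)) := by
  classical
  rw [BalancedGD, not_and_or] at hbal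
  rcases hbal with hconn | hcut
  · push Not at hconn
    obtain ⟨s, t, hst⟩ := hconn
    set E : V → V → Prop := fun x y => (x ∈ L ∧ y = M x) ∨ (x, y) ∈ D
    set S : Finset V := {w | ¬ Relation.ReflTransGen E s w} with hS
    have hmem : ∀ w, w ∈ S ↔ ¬ Relation.ReflTransGen E s w := fun w => by simp [hS]
    have hclosed : ∀ a b, E a b → a ∉ S → b ∉ S := by
      intro a b hab ha hb
      rw [hmem] at ha hb
      exact hb ((not_not.1 ha).tail hab)
    have hk : #{u ∈ L | u ∉ S ∧ M u ∈ S} = 0 := by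
      rw [card_eq_zero, filter_eq_empty_iff]
      rintro u hu ⟨h1, h2⟩
      exact hclosed u (M u) (Or.inl ⟨hu, rfl⟩) h1 h2
    have hd : #{p ∈ (R \ S) ×ˢ (L ∩ S) | p ∈ D} = 0 := by
      rw [card_eq_zero, filter_eq_empty_iff]
      rintro ⟨a, b⟩ hab habD
      simp only [mem_product, mem_sdiff, mem_inter] at hab
      exact hclosed a b (Or.inr habD) hab.1.2 hab.2.2
    have hs : s ∉ S := by simp [hmem, Relation.ReflTransGen.refl]
    have ht : t ∈ S := (hmem t).2 hst
    have hLR : ∀ w, w ∈ L ∨ w ∈ R := fun w => mem_union.1 (hcov ▸ mem_univ w)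
    have hx : 0 < #(R \ S) := by
      rw [card_pos]
      rcases hLR s with h | h
      · exact ⟨M s, mem_sdiff.2 ⟨by exact_mod_cast hM.mapsTo h,
          hclosed s (M s) (Or.inl ⟨h, rfl⟩) hs⟩⟩
      · exact ⟨s, mem_sdiff.2 ⟨h, hs⟩⟩
    have hy : 0 < #(L ∩ S) := by
      rw [card_pos]
      rcases hLR t with h | h
      · exact ⟨t, mem_inter.2 ⟨h, ht⟩⟩
      · obtain ⟨u, hu, rfl⟩ := hM.surjOn h
        refine ⟨u, mem_inter.2 ⟨hu, ?_⟩⟩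
        by_contra huS
        exact hclosed u (M u) (Or.inl ⟨hu, rfl⟩) huS ht
    refine ⟨S, ?_⟩
    rw [hk, hd]
    have := Nat.mul_pos hx hy
    omega
  · push Not at hcut
    obtain ⟨S, hS⟩ := hcut
    have hS' : 8 * n * eCount L M D Sᶜ < eCount L M D S := by exact_mod_cast hS
    exact ⟨S, ((Nat.mul_le_mul_left _
      (card_filter_add_card_filter_le_eCount_compl hdisj S)).trans_lt hS').trans_le
        (eCount_le hL hR hM hD S)⟩

lemma exists_empty_rectangle_of_not_balancedGD (hn : 32 ≤ n) (hdisj : Disjoint L R)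
    (hcov : L ∪ R = univ) (hL : #L = n) (hR : #R = n) (hM : Set.BijOn M ↑L ↑R)
    (hD : D ⊆ R ×ˢ L) (hbal : ¬ BalancedGD (8 * n : ℝ) L M D) :
    ∃ X ⊆ R, ∃ Y ⊆ L, (∀ a ∈ X, ∀ b ∈ Y, (a, b) ∉ D) ∧
      (4 * n ≤ #X * #Y ∨ (#X = 1 ∧ #Y = n - 32) ∨ (#X = n - 32 ∧ #Y = 1)) := by
  obtain ⟨S, hS⟩ := exists_sparse_cut_of_not_balancedGD hdisj hcov hL hR hM hD hbal
  have heq := card_add_card_filter_eq hM S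
  have hx : #(R \ S) + #(R ∩ S) = n := by rw [← hR]; exact card_sdiff_add_card_inter R S
  have hy : #(L \ S) + #(L ∩ S) = n := by rw [← hL]; exact card_sdiff_add_card_inter L S
  have hsum : n ≤ #(R \ S) + #(L ∩ S) + #{u ∈ L | u ∉ S ∧ M u ∈ S} := by omega
  have hxn : #(R \ S) ≤ n := by omega
  have hyn : #(L ∩ S) ≤ n := by omega
  clear heq hx hy
  generalize #{u ∈ L | u ∉ S ∧ M u ∈ S} = k at *
  have hkey : ∀ {x y d : ℕ}, y ≤ n → 8 * n * (k + d) < n * k + 2 * (x * y) →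
      4 * d < x ∧ k ≤ x := by
    intro x y d hy h
    have h1 : x * y ≤ n * x := by rw [mul_comm]; exact Nat.mul_le_mul_right _ hy
    have h2 : n * (7 * k + 8 * d) < n * (2 * x) := by nlinarith
    have := Nat.lt_of_mul_lt_mul_left h2
    omega
  rcases le_total #(R \ S) #(L ∩ S) with hle | hle
  · obtain ⟨hd, hk⟩ := hkey hyn hS
    obtain ⟨X, hX, Y, hY, he, hc⟩ := exists_empty_rectangle (fun a b => (a, b) ∈ D) hn hd hle
      (by omega)
    exact ⟨X, hX.trans sdiff_subset, Y, hY.trans inter_subset_left, he, by tauto⟩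
  · have hswap : #{p ∈ (R \ S) ×ˢ (L ∩ S) | p ∈ D} =
        #{p ∈ (L ∩ S) ×ˢ (R \ S) | (p.2, p.1) ∈ D} := by
      refine card_equiv (Equiv.prodComm V V) ?_
      rintro ⟨a, b⟩
      simp only [mem_filter, mem_product, Equiv.prodComm_apply, Prod.swap_prod_mk]
      tauto
    rw [hswap, mul_comm #(R \ S)] at hS
    obtain ⟨hd, hk⟩ := hkey hxn hS
    obtain ⟨Y, hY, X, hX, he, hc⟩ := exists_empty_rectangle (fun b a => (a, b) ∈ D) hn hd hle
      (by omega)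
    refine ⟨X, hX.trans sdiff_subset, Y, hY.trans inter_subset_left,
      fun a ha b hb => he b hb a ha, ?_⟩
    rw [mul_comm #X]
    tauto

lemma ncard_not_balancedGD_le (hn : 32 ≤ n) (hdisj : Disjoint L R)
    (hcov : L ∪ R = univ) (hL : #L = n) (hR : #R = n) (hM : Set.BijOn M ↑L ↑R) :
    {D : Finset (V × V) | D ⊆ R ×ˢ L ∧ ¬ BalancedGD (8 * n : ℝ) L M D}.ncard ≤
      2 ^ n * 2 ^ n * 2 ^ (n ^ 2 - 4 * n) + 2 * (n * n ^ 32 * 2 ^ (n ^ 2 - (n - 32))) := by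
  let B : Finset V × Finset V → Finset (Finset (V × V)) := fun q =>
    {D ∈ (R ×ˢ L).powerset | ∀ a ∈ q.1, ∀ b ∈ q.2, (a, b) ∉ D}
  let F₁ := {q ∈ R.powerset ×ˢ L.powerset | 4 * n ≤ #q.1 * #q.2}
  let F₂ := R.powersetCard 1 ×ˢ L.powersetCard (n - 32)
  let F₃ := R.powersetCard (n - 32) ×ˢ L.powersetCard 1
  have hsub : {D : Finset (V × V) | D ⊆ R ×ˢ L ∧ ¬ BalancedGD (8 * n : ℝ) L M D} ⊆
      ↑(F₁.biUnion B ∪ (F₂.biUnion B ∪ F₃.biUnion B)) := by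
    rintro D ⟨hD, hbal⟩
    obtain ⟨X, hX, Y, hY, he, hc⟩ :=
      exists_empty_rectangle_of_not_balancedGD hn hdisj hcov hL hR hM hD hbal
    have hB : D ∈ B (X, Y) := mem_filter.2 ⟨mem_powerset.2 hD, he⟩
    simp only [mem_coe, mem_union, mem_biUnion]
    rcases hc with hc | ⟨h1, h2⟩ | ⟨h1, h2⟩
    · exact Or.inl ⟨(X, Y), by simp [F₁, hX, hY, hc], hB⟩
    · exact Or.inr (Or.inl ⟨(X, Y), by simp [F₂, mem_powersetCard, hX, hY, h1, h2], hB⟩)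
    · exact Or.inr (Or.inr ⟨(X, Y), by simp [F₃, mem_powersetCard, hX, hY, h1, h2], hB⟩)
  have hB : ∀ {X Y : Finset V} {m : ℕ}, X ⊆ R → Y ⊆ L → m ≤ #X * #Y →
      #(B (X, Y)) ≤ 2 ^ (n ^ 2 - m) := fun hX hY hm =>
    (by convert card_powerset_filter_disjoint_le hL hR hX hY : #(B _) ≤ _).trans
      (Nat.pow_le_pow_right two_pos (Nat.sub_le_sub_left hm _))
  have hch : n.choose (n - 32) ≤ n ^ 32 := by
    rw [Nat.choose_symm hn]
    exact Nat.choose_le_pow n 32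
  have h1 : #(F₁.biUnion B) ≤ 2 ^ n * 2 ^ n * 2 ^ (n ^ 2 - 4 * n) := by
    refine (card_biUnion_le_card_mul _ _ (2 ^ (n ^ 2 - 4 * n)) ?_).trans
      (Nat.mul_le_mul_right _ ?_)
    · rintro ⟨X, Y⟩ hq
      simp only [F₁, mem_filter, mem_product, mem_powerset] at hq
      exact hB hq.1.1 hq.1.2 hq.2
    · refine (card_filter_le _ _).trans_eq ?_
      rw [card_product, card_powerset, card_powerset, hL, hR]
  have h2 : #(F₂.biUnion B) ≤ n * n ^ 32 * 2 ^ (n ^ 2 - (n - 32)) := by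
    refine (card_biUnion_le_card_mul _ _ (2 ^ (n ^ 2 - (n - 32))) ?_).trans
      (Nat.mul_le_mul_right _ ?_)
    · rintro ⟨X, Y⟩ hq
      simp only [F₂, mem_product, mem_powersetCard] at hq
      exact hB hq.1.1 hq.2.1 (by rw [hq.1.2, hq.2.2, one_mul])
    · rw [card_product, card_powersetCard, card_powersetCard, hL, hR, Nat.choose_one_right]
      exact Nat.mul_le_mul_left _ hch
  have h3 : #(F₃.biUnion B) ≤ n * n ^ 32 * 2 ^ (n ^ 2 - (n - 32)) := by
    refine (card_biUnion_le_card_mul _ _ (2 ^ (n ^ 2 - (n - 32))) ?_).trans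
      (Nat.mul_le_mul_right _ ?_)
    · rintro ⟨X, Y⟩ hq
      simp only [F₃, mem_product, mem_powersetCard] at hq
      exact hB hq.1.1 hq.2.1 (by rw [hq.1.2, hq.2.2, mul_one])
    · rw [card_product, card_powersetCard, card_powersetCard, hL, hR, Nat.choose_one_right,
        mul_comm]
      exact Nat.mul_le_mul_left _ hch
  have h4 := Set.ncard_le_ncard hsub (finite_toSet _)
  rw [Set.ncard_coe_finset] at h4
  have h5 := card_union_le (F₁.biUnion B) (F₂.biUnion B ∪ F₃.biUnion B)
  have h6 := card_union_le (F₂.biUnion B) (F₃.biUnion B)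
  omega

end Cuts

lemma eventually_mul_pow_le_two_pow (c k : ℕ) :
    ∀ᶠ n : ℕ in Filter.atTop, c * n ^ k ≤ 2 ^ n := by
  have h := (tendsto_pow_const_div_const_pow_of_one_lt k (one_lt_two (α := ℝ))).const_mul (c : ℝ)
  rw [mul_zero] at h
  filter_upwards [h.eventually_lt_const one_pos] with n hn
  rw [← mul_div_assoc, div_lt_one (by positivity)] at hn
  exact_mod_cast hn.le

/-- Lemma `rand-balanced`: for all large enough `n`, at most a `1/n` fraction of the
`2^{n²}` subsets `D ⊆ R × L` yield a digraph `G_D` that is not `8n`-balanced. -/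
theorem few_unbalanced_bipartite_graphs :
    ∃ n₀ : ℕ, ∀ n : ℕ, n₀ ≤ n →
      ∀ (V : Type) [Fintype V] [DecidableEq V] (L R : Finset V) (M : V → V),
        Disjoint L R → L ∪ R = Finset.univ → L.card = n → R.card = n →
        Set.BijOn M ↑L ↑R →
        ({D : Finset (V × V) | D ⊆ R ×ˢ L ∧ ¬ BalancedGD (8 * n : ℝ) L M D}.ncard : ℝ) ≤
          (2 : ℝ) ^ (n ^ 2) / (n : ℝ) := by
  obtain ⟨n₁, hn₁⟩ := Filter.eventually_atTop.1 (eventually_mul_pow_le_two_pow (2 ^ 34) 34)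
  refine ⟨max n₁ 32, fun n hn V _ _ L R M hdisj hcov hL hR hM => ?_⟩
  have hn32 : 32 ≤ n := (le_max_right _ _).trans hn
  have hpow : 2 ^ 34 * n ^ 34 ≤ 2 ^ n := hn₁ n ((le_max_left _ _).trans hn)
  have hcount := ncard_not_balancedGD_le hn32 hdisj hcov hL hR hM
  rw [le_div_iff₀ (by exact_mod_cast (by omega : 0 < n))]
  generalize {D : Finset (V × V) | D ⊆ R ×ˢ L ∧ ¬ BalancedGD (8 * n : ℝ) L M D}.ncard = N at *
  suffices h : N * n ≤ 2 ^ (n ^ 2) by exact_mod_cast h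
  obtain ⟨m, hm⟩ : ∃ m, n ^ 2 = m + 4 * n := ⟨n ^ 2 - 4 * n, by
    have : 4 * n ≤ n ^ 2 := by nlinarith
    omega⟩
  have e1 : n ^ 2 - 4 * n = m := by omega
  have e2 : n ^ 2 - (n - 32) = m + 3 * n + 32 := by omega
  have hlt : n ≤ 2 ^ n := Nat.lt_two_pow_self.le
  have h2 : 2 ≤ 2 ^ n := Nat.le_self_pow (by omega) 2
  rw [e1, e2] at hcount
  rw [hm]
  have e3 : 2 ^ (m + 3 * n + 32) = 2 ^ 32 * (2 ^ m * (2 ^ n) ^ 3) := by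
    rw [pow_add, pow_add, ← pow_mul, mul_comm n 3]; ring
  have e4 : 2 ^ (m + 4 * n) = 2 ^ m * (2 ^ n) ^ 4 := by
    rw [pow_add, ← pow_mul, mul_comm n 4]
  rw [e3] at hcount
  rw [e4]
  generalize 2 ^ n = t at *
  generalize 2 ^ m = s at *
  have f1 : 2 * (t * t * s * n) ≤ s * t ^ 4 :=
    calc 2 * (t * t * s * n) ≤ t * (t * t * s * t) := by gcongr
      _ = s * t ^ 4 := by ring
  have f2 : 2 * (2 * (n * n ^ 32 * (2 ^ 32 * (s * t ^ 3))) * n) ≤ s * t ^ 4 :=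
    calc 2 * (2 * (n * n ^ 32 * (2 ^ 32 * (s * t ^ 3))) * n)
        = 2 ^ 34 * n ^ 34 * (s * t ^ 3) := by ring
      _ ≤ t * (s * t ^ 3) := by gcongr
      _ = s * t ^ 4 := by ring
  have f3 := Nat.mul_le_mul_right n hcount
  rw [add_mul] at f3
  omega
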